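/- Let H be a complex Hilbert space, W a bounded self-adjoint operator on H, and T a closed, W-accretive operator in H (i.e. Re (WTx, x) ≥ 0 for all x ∈ dom(T)) such that iℝ \ {0} ⊂ ρ(T). Assume that the principal value integral (1/(πi)) ∫_{iℝ} (T − z)^{-1} dz exists in the weak operator topology and equals Q_+ − Q_− for a pair of complementary bounded projections Q_± ∈ L(H) (Q_+ + Q_− = I). Then Q_+ H is a W-nonnegative subspace and Q_− H is a W-nonpositive subspace. If moreover 0 ∈ ρ(W), let P_± be the spectral projections of W onto its positive and negative spectral subspaces, H_± := P_± H and W_± := ±W|_{H_±}; then there exist operators K_± ∈ L(H_±, H_∓) such that Q_+ H = {x + K_+ x : x ∈ P_+ H} and Q_− H = {y + K_− y : y ∈ P_− H}, and ‖K_±‖ ≤ √( sup σ(W_±) / inf σ(W_∓) ). -/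

import Mathlib

noncomputable section

open Complex Filter Topology MeasureTheory

namespace Paper

variable {X : Type*} [NormedAddCommGroup X] [NormedSpace ℂ X]

/-- `R` is a (two-sided) bounded resolvent of the unbounded operator `T` at the point `z`. -/
def IsResolventAt (T : X →ₗ.[ℂ] X) (z : ℂ) (R : X →L[ℂ] X) : Prop :=
  (∀ u : T.domain, R (T u - z • (u : X)) = u) ∧
  (∀ y : X, ∃ hy : R y ∈ T.domain, T ⟨R y, hy⟩ - z • R y = y)

/-- The resolvent set of an unbounded operator. -/
def resolventSet (T : X →ₗ.[ℂ] X) : Set ℂ := {z | ∃ R, IsResolventAt T z R}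

/-- The spectrum of an unbounded operator. -/
def spec (T : X →ₗ.[ℂ] X) : Set ℂ := (resolventSet T)ᶜ

open Classical in
/-- The resolvent operator of `T` at `z` (junk value `0` if `z` is not in the resolvent set). -/
def res (T : X →ₗ.[ℂ] X) (z : ℂ) : X →L[ℂ] X :=
  if h : z ∈ resolventSet T then Classical.choose h else 0

open Classical in
/-- Application of an unbounded operator, with junk value `0` outside of the domain. -/
def pApply (T : X →ₗ.[ℂ] X) (u : X) : X :=
  if h : u ∈ T.domain then T ⟨u, h⟩ else 0

/-- `R` is a bounded resolvent at `z` of the part of `T` in the range of the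
(not necessarily orthogonal) projection `Q`. -/
def IsPartResolventAt (T : X →ₗ.[ℂ] X) (Q : X →L[ℂ] X) (z : ℂ) (R : X →L[ℂ] X) : Prop :=
  (∀ y, R (Q y) = R y) ∧ (∀ y, Q (R y) = R y) ∧
  (∀ y, ∃ hy : R y ∈ T.domain, T ⟨R y, hy⟩ - z • R y = Q y) ∧
  (∀ u : T.domain, Q (u : X) = (u : X) → R (T u - z • (u : X)) = (u : X))

/-- The spectrum of the part `T|_{ran Q}` of `T` in the range of the projection `Q`. -/
def partSpec (T : X →ₗ.[ℂ] X) (Q : X →L[ℂ] X) : Set ℂ :=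
  {z | ¬∃ R, IsPartResolventAt T Q z R}

/-- `T` is decomposed according to `X = Q₊X ∔ Q₋X`: the `Q₊, Q₋` are complementary (bounded)
projections whose ranges are invariant under `T`. -/
def DecomposedBy (T : X →ₗ.[ℂ] X) (Qp Qm : X →L[ℂ] X) : Prop :=
  Qp + Qm = 1 ∧ IsIdempotentElem Qp ∧ IsIdempotentElem Qm ∧
  (∀ u : T.domain, ∃ hp : Qp (u : X) ∈ T.domain, T ⟨Qp (u : X), hp⟩ = Qp (T u)) ∧
  (∀ u : T.domain, ∃ hm : Qm (u : X) ∈ T.domain, T ⟨Qm (u : X), hm⟩ = Qm (T u))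

/-- `D` is a core for the closed operator `T`: the closure of the restriction of `T` to `D`
is again `T`. -/
def IsCore (T : X →ₗ.[ℂ] X) (D : Submodule ℂ X) : Prop :=
  D ≤ T.domain ∧ (T.domRestrict D).closure = T

/-- The operator `W⁻¹ T W` (with `W' = W⁻¹`). -/
def conjPMap (W W' : X →L[ℂ] X) (T : X →ₗ.[ℂ] X) : X →ₗ.[ℂ] X where
  domain := T.domain.comap (W : X →ₗ[ℂ] X)
  toFun := (W' : X →ₗ[ℂ] X) ∘ₗ (T.toFun ∘ₗ ((W : X →ₗ[ℂ] X).restrict fun _ hx => hx))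

/-- The linear span of the graph of `f` restricted to `D`; if `f` is linear on `D` this is
the graph of the corresponding operator with domain `D`. -/
def graphSpan (D : Submodule ℂ X) (f : X → X) : Submodule ℂ (X × X) :=
  Submodule.span ℂ {p : X × X | p.1 ∈ D ∧ p.2 = f p.1}

/-- The unbounded operator with domain `D` acting as `f` (obtained from the span of the
graph of `f|_D`). -/
def pmapOf (D : Submodule ℂ X) (f : X → X) : X →ₗ.[ℂ] X := (graphSpan D f).toLinearPMap
section Hilbert

variable {H : Type*} [NormedAddCommGroup H] [InnerProductSpace ℂ H] [CompleteSpace H]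

local notation "⟪" x ", " y "⟫" => @inner ℂ _ _ x y

/-- The inverse of a bounded operator `J`, as an unbounded operator (defined via the
flipped graph of `J`; if `J` is injective this is the genuine inverse with domain `ran J`). -/
def pinv (J : H →L[ℂ] H) : H →ₗ.[ℂ] H :=
  ((LinearMap.graph (J : H →ₗ[ℂ] H)).map
    ((LinearEquiv.prodComm ℂ H H) : H × H →ₗ[ℂ] H × H)).toLinearPMap

/-- For `R` self-adjoint, `|R| = √(R²)`. -/
def absCLM (R : H →L[ℂ] H) : H →L[ℂ] H := CFC.sqrt (R * R)

/-- For `R = H₀⁻¹` with `H₀` self-adjoint, this is `|H₀|^{-1/2} = √(|R|)`. -/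
def invSqrtAbs (R : H →L[ℂ] H) : H →L[ℂ] H := CFC.sqrt (absCLM R)

/-- For `R = H₀⁻¹` with `H₀` self-adjoint, this is the unbounded operator `|H₀|^{1/2}`,
realized as the inverse of `|H₀|^{-1/2}`; its domain is `dom |H₀|^{1/2}`. -/
def sqrtAbsPMap (R : H →L[ℂ] H) : H →ₗ.[ℂ] H := pinv (invSqrtAbs R)

/-- `U` is the sign `sign(H₀) = sign(H₀⁻¹) = sign(R)` of the boundedly invertible self-adjoint
operator `H₀ = R⁻¹`: a self-adjoint involution with `R U = U R = |R|`. -/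
def IsSignOf (U R : H →L[ℂ] H) : Prop :=
  IsSelfAdjoint U ∧ U * U = 1 ∧ R * U = absCLM R ∧ U * R = absCLM R

/-- The quadratic form `h₀` represented by `H₀ = R⁻¹`:
`h₀[u,w] = (|H₀|^{1/2}u, sign(H₀)|H₀|^{1/2}w)`, linear in `u` and conjugate-linear in `w`
(values outside `dom |H₀|^{1/2}` are junk). -/
def h0form (R U : H →L[ℂ] H) (u w : H) : ℂ :=
  ⟪U (pApply (sqrtAbsPMap R) w), pApply (sqrtAbsPMap R) u⟫

/-- `v` is a sesquilinear form on `Q` (linear in the first, conjugate-linear in the second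
argument, as in the paper). -/
def SesqOn (Q : Submodule ℂ H) (v : H → H → ℂ) : Prop :=
  (∀ u₁ u₂ w, u₁ ∈ Q → u₂ ∈ Q → w ∈ Q → v (u₁ + u₂) w = v u₁ w + v u₂ w) ∧
  (∀ (c : ℂ) u w, u ∈ Q → w ∈ Q → v (c • u) w = c * v u w) ∧
  (∀ u w₁ w₂, u ∈ Q → w₁ ∈ Q → w₂ ∈ Q → v u (w₁ + w₂) = v u w₁ + v u w₂) ∧
  (∀ (c : ℂ) u w, u ∈ Q → w ∈ Q → v u (c • w) = (starRingEnd ℂ) c * v u w)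

/-- `T` is the operator associated with the densely defined sesquilinear form `h`
with form domain `Q` (in the sense of the paper):
`T` is closed and densely defined, `dom T, dom T* ⊆ Q`, `(Tu, w) = h[u, w]` for
`u ∈ dom T`, `w ∈ Q`, and `(u, T*w) = h[u, w]` for `u ∈ Q`, `w ∈ dom T*`.
(The paper's inner product `(·,·)` is linear in the first argument, so
`(x, y) = ⟪y, x⟫` in Mathlib conventions.) -/
def IsAssocForm (Q : Submodule ℂ H) (h : H → H → ℂ) (T : H →ₗ.[ℂ] H) : Prop :=
  T.IsClosed ∧ Dense (T.domain : Set H) ∧ T.domain ≤ Q ∧ T.adjoint.domain ≤ Q ∧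
  (∀ u : T.domain, ∀ w ∈ Q, ⟪w, T u⟫ = h u w) ∧
  (∀ u ∈ Q, ∀ w : T.adjoint.domain, ⟪T.adjoint w, u⟫ = h u w)

/-- `‖H_{a,b}^{1/2} u‖ = (a‖u‖² + b‖|H₀|^{1/2}u‖²)^{1/2}` for `u ∈ dom |H₀|^{1/2}`,
where `H_{a,b} = a + b|H₀|` and `R = H₀⁻¹`. -/
def habNorm (R : H →L[ℂ] H) (a b : ℝ) (u : H) : ℝ :=
  Real.sqrt (a * ‖u‖ ^ 2 + b * ‖pApply (sqrtAbsPMap R) u‖ ^ 2)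

/-- `Pp, Pm` are the spectral projections of the bounded self-adjoint operator `R` onto its
positive and negative spectral subspaces (`R` is assumed injective, e.g. the inverse of a
self-adjoint operator, so that the pair is uniquely determined). -/
def IsPosNegPair (R Pp Pm : H →L[ℂ] H) : Prop :=
  Pp + Pm = 1 ∧ IsSelfAdjoint Pp ∧ IsSelfAdjoint Pm ∧
  IsIdempotentElem Pp ∧ IsIdempotentElem Pm ∧
  Pp * R = R * Pp ∧
  (∀ x : H, 0 ≤ (⟪Pp x, R (Pp x)⟫).re) ∧ (∀ x : H, (⟪Pm x, R (Pm x)⟫).re ≤ 0)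

/-- Membership in the Schatten-von Neumann class of order `p`, via the Schmidt
representation `A = ∑ sₙ ⟪eₙ, ·⟫ fₙ` with `(sₙ) ∈ ℓᵖ`. -/
def MemSchatten (p : ℝ) (A : H →L[ℂ] H) : Prop :=
  ∃ (s : ℕ → ℝ) (e f : ℕ → H), Orthonormal ℂ e ∧ Orthonormal ℂ f ∧ (∀ n, 0 ≤ s n) ∧
    Summable (fun n => s n ^ p) ∧
    ∀ x : H, HasSum (fun n => s n • (⟪e n, x⟫ • f n)) (A x)

end Hilbert


section Statement6

variable {H : Type*} [NormedAddCommGroup H] [InnerProductSpace ℂ H] [CompleteSpace H]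

local notation "⟪" x ", " y "⟫" => @inner ℂ _ _ x y

/-!
STATEMENT 6: Let `W` be a bounded self-adjoint operator on a complex Hilbert space `H` and
`T` a closed `W`-accretive operator (i.e. `Re (WTx, x) ≥ 0` on `dom T`; in Mathlib
conventions `(WTx, x) = ⟪x, W(Tx)⟫`) with `iℝ \ {0} ⊆ ρ(T)`.  Assume that the principal
value integral `(1/(πi)) ∫_{iℝ} (T - z)⁻¹ dz = (1/π) ∫'_ℝ (T - iη)⁻¹ dη` exists in the weak
operator topology and equals `Q₊ - Q₋` for complementary bounded projections `Q₊, Q₋`.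
Then `Q₊H` is `W`-nonnegative and `Q₋H` is `W`-nonpositive.  If moreover `0 ∈ ρ(W)` and
`P₊, P₋` are the spectral projections of `W` onto its positive/negative spectral subspaces
(`H± := P±H`, `W± := ±W|_{H±}`), then `Q₊H` and `Q₋H` are graphs of operators
`K± ∈ L(H±, H∓)` with `‖K±‖ ≤ √(sup σ(W±)/inf σ(W∓))`.
(Here `sup σ(W₊) = sup {⟪x,Wx⟫ : x ∈ H₊, ‖x‖=1}` etc., by the spectral theorem for bounded
self-adjoint operators; `K±` are encoded as operators on `H` vanishing on `H∓` and mapping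
`H±` into `H∓`.)
-/

lemma IsPosNegPair.neg {W Pp Pm : H →L[ℂ] H} (h : IsPosNegPair W Pp Pm) :
    IsPosNegPair (-W) Pm Pp := by
  obtain ⟨h1, h2, h3, h4, h5, h6, h7, h8⟩ := h
  have hm : Pm = 1 - Pp := eq_sub_of_add_eq' h1
  refine ⟨by rw [add_comm, h1], h3, h2, h5, h4, ?_, fun x => ?_, fun x => ?_⟩
  · simp only [hm, sub_mul, mul_sub, mul_neg, neg_mul, h6, one_mul, mul_one]
    abel
  · simpa using h8 x
  · simpa using h7 x

lemma IsPosNegPair.apply_add {W Pp Pm : H →L[ℂ] H} (h : IsPosNegPair W Pp Pm) (x : H) :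
    Pp x + Pm x = x := by
  simpa using DFunLike.congr_fun h.1 x

lemma IsPosNegPair.apply_apply {W Pp Pm : H →L[ℂ] H} (h : IsPosNegPair W Pp Pm) (x : H) :
    Pp (Pp x) = Pp x :=
  DFunLike.congr_fun h.2.2.2.1 x

lemma IsPosNegPair.apply_comm {W Pp Pm : H →L[ℂ] H} (h : IsPosNegPair W Pp Pm) (x : H) :
    Pp (W x) = W (Pp x) :=
  DFunLike.congr_fun h.2.2.2.2.2.1 x

lemma IsPosNegPair.apply_apply_neg {W Pp Pm : H →L[ℂ] H} (h : IsPosNegPair W Pp Pm) (x : H) :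
    Pp (Pm x) = 0 := by
  have := h.apply_apply x
  have h2 := congrArg Pp (h.apply_add x)
  rw [map_add, this] at h2
  simpa using h2

lemma IsPosNegPair.inner_apply_left {W Pp Pm : H →L[ℂ] H} (h : IsPosNegPair W Pp Pm) (x y : H) :
    ⟪Pp x, y⟫ = ⟪x, Pp y⟫ :=
  h.2.1.isSymmetric x y

lemma IsPosNegPair.inner_eq_zero {W Pp Pm : H →L[ℂ] H} (h : IsPosNegPair W Pp Pm) (x y : H) :
    ⟪Pp x, Pm y⟫ = 0 := by
  rw [h.inner_apply_left, h.apply_apply_neg, inner_zero_right]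

lemma IsPosNegPair.norm_sq {W Pp Pm : H →L[ℂ] H} (h : IsPosNegPair W Pp Pm) (x y : H) :
    ‖Pp x + Pm y‖ ^ 2 = ‖Pp x‖ ^ 2 + ‖Pm y‖ ^ 2 := by
  rw [@norm_add_sq ℂ, h.inner_eq_zero]
  simp

/-- The quadratic form of `W` splits along its spectral projections. -/
lemma IsPosNegPair.re_inner_split {W Pp Pm : H →L[ℂ] H} (h : IsPosNegPair W Pp Pm) (x : H) :
    (⟪x, W x⟫).re = (⟪Pp x, W (Pp x)⟫).re + (⟪Pm x, W (Pm x)⟫).re := by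
  have h1 : ⟪Pp x, W (Pm x)⟫ = 0 := by
    rw [h.inner_apply_left, h.apply_comm, h.apply_apply_neg, map_zero, inner_zero_right]
  have h2 : ⟪Pm x, W (Pp x)⟫ = 0 := by
    have := h.neg.inner_apply_left x (W (Pp x))
    have h3 := h.neg.apply_comm (Pp x)
    simp only [neg_apply, map_neg, neg_inj] at h3
    rw [this, h3, h.neg.apply_apply_neg, map_zero, inner_zero_right]
  conv_lhs => rw [← h.apply_add x]
  simp only [map_add, inner_add_left, inner_add_right, h1, h2, add_zero, zero_add,
    Complex.add_re]

/-- If `W` is invertible, its quadratic form is bounded below on the positive spectral subspace. -/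
lemma IsPosNegPair.exists_pos_lower_bound {W Pp Pm : H →L[ℂ] H} (h : IsPosNegPair W Pp Pm)
    (hWsa : IsSelfAdjoint W) (hW : IsUnit W) :
    ∃ c : ℝ, 0 < c ∧ ∀ x : H, Pp x = x → c * ‖x‖ ^ 2 ≤ (⟪x, W x⟫).re := by
  obtain ⟨V, hV⟩ := hW.exists_left_inv
  set M := ‖W‖ + 1 with hM
  set N := ‖V‖ + 1 with hN
  have hMpos : 0 < M := by positivity
  have hNpos : 0 < N := by positivity
  refine ⟨(M * N ^ 2)⁻¹, by positivity, fun x hx => ?_⟩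
  set w := W x with hw
  have hPw : Pp w = w := by rw [hw, h.apply_comm, hx]
  have hxw : ‖x‖ ≤ N * ‖w‖ := by
    have : x = V w := (DFunLike.congr_fun hV x).symm
    calc ‖x‖ = ‖V w‖ := congrArg _ this
      _ ≤ ‖V‖ * ‖w‖ := V.le_opNorm w
      _ ≤ N * ‖w‖ := by gcongr; linarith
  have hww : (⟪w, W w⟫).re ≤ M * ‖w‖ ^ 2 := by
    calc (⟪w, W w⟫).re ≤ ‖w‖ * ‖W w‖ := re_inner_le_norm (𝕜 := ℂ) w (W w)
      _ ≤ ‖w‖ * (‖W‖ * ‖w‖) := by gcongr; exact W.le_opNorm w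
      _ ≤ ‖w‖ * (M * ‖w‖) := by gcongr; linarith
      _ = M * ‖w‖ ^ 2 := by ring
  have hpos := h.2.2.2.2.2.2.1 (x - ((M⁻¹ : ℝ) : ℂ) • w)
  have hexp : (⟪x - ((M⁻¹ : ℝ) : ℂ) • w, W (x - ((M⁻¹ : ℝ) : ℂ) • w)⟫).re =
      (⟪x, w⟫).re - 2 * M⁻¹ * ‖w‖ ^ 2 + M⁻¹ ^ 2 * (⟪w, W w⟫).re := by
    have h1 : ⟪x, W w⟫ = ⟪w, w⟫ := (hWsa.isSymmetric x w).symm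
    have h2 : (⟪w, w⟫).re = ‖w‖ ^ 2 := inner_self_eq_norm_sq (𝕜 := ℂ) w
    rw [map_sub, map_smul, ← hw]
    simp only [inner_sub_left, inner_sub_right, inner_smul_left, inner_smul_right, h1,
      Complex.conj_ofReal, Complex.sub_re, Complex.re_ofReal_mul, h2]
    ring
  rw [map_sub, map_smul, hx, hPw, hexp] at hpos
  have h3 : M⁻¹ ^ 2 * (⟪w, W w⟫).re ≤ M⁻¹ * ‖w‖ ^ 2 := by
    calc M⁻¹ ^ 2 * (⟪w, W w⟫).re ≤ M⁻¹ ^ 2 * (M * ‖w‖ ^ 2) := by gcongr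
      _ = M⁻¹ * ‖w‖ ^ 2 := by field_simp
  calc (M * N ^ 2)⁻¹ * ‖x‖ ^ 2 ≤ (M * N ^ 2)⁻¹ * (N * ‖w‖) ^ 2 := by gcongr
    _ = M⁻¹ * ‖w‖ ^ 2 := by field_simp
    _ ≤ (⟪x, w⟫).re := by linarith

omit [CompleteSpace H] in
/-- The quadratic form of `W` on the unit vector `x / ‖x‖`. -/
lemma exists_unit_re_inner {W P : H →L[ℂ] H} {x : H} (hx : P x = x) (hx0 : x ≠ 0) :
    ∃ e : H, P e = e ∧ ‖e‖ = 1 ∧ (⟪x, W x⟫).re = (⟪e, W e⟫).re * ‖x‖ ^ 2 := by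
  have hn : ‖x‖ ≠ 0 := norm_ne_zero_iff.mpr hx0
  refine ⟨((‖x‖⁻¹ : ℝ) : ℂ) • x, by rw [map_smul, hx], ?_, ?_⟩
  · rw [norm_smul, Complex.norm_real, norm_inv, norm_norm, inv_mul_cancel₀ hn]
  · rw [map_smul, inner_smul_left, inner_smul_right, Complex.conj_ofReal,
      Complex.re_ofReal_mul, Complex.re_ofReal_mul]
    field_simp

omit [CompleteSpace H] in
lemma re_inner_le_of_isLUB {W P : H →L[ℂ] H} {s : ℝ}
    (hs : IsLUB {r : ℝ | ∃ x : H, P x = x ∧ ‖x‖ = 1 ∧ r = (⟪x, W x⟫).re} s)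
    {x : H} (hx : P x = x) : (⟪x, W x⟫).re ≤ s * ‖x‖ ^ 2 := by
  rcases eq_or_ne x 0 with rfl | hx0
  · simp
  · obtain ⟨e, he, he1, heq⟩ := exists_unit_re_inner (W := W) hx hx0
    rw [heq]
    gcongr
    exact hs.1 ⟨e, he, he1, rfl⟩

omit [CompleteSpace H] in
lemma le_re_inner_of_isGLB {W P : H →L[ℂ] H} {i : ℝ}
    (hi : IsGLB {r : ℝ | ∃ x : H, P x = x ∧ ‖x‖ = 1 ∧ r = (⟪x, W x⟫).re} i)
    {x : H} (hx : P x = x) : i * ‖x‖ ^ 2 ≤ (⟪x, W x⟫).re := by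
  rcases eq_or_ne x 0 with rfl | hx0
  · simp
  · obtain ⟨e, he, he1, heq⟩ := exists_unit_re_inner (W := W) hx hx0
    rw [heq]
    gcongr
    exact hi.1 ⟨e, he, he1, rfl⟩

lemma IsPosNegPair.isGLB_pos {W Pp Pm : H →L[ℂ] H} (h : IsPosNegPair W Pp Pm)
    (hWsa : IsSelfAdjoint W) (hW : IsUnit W) {i : ℝ}
    (hi : IsGLB {r : ℝ | ∃ x : H, Pp x = x ∧ ‖x‖ = 1 ∧ r = (⟪x, W x⟫).re} i) : 0 < i := by
  obtain ⟨c, hc, hcb⟩ := h.exists_pos_lower_bound hWsa hW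
  refine hc.trans_le (hi.2 ?_)
  rintro r ⟨x, hx, hx1, rfl⟩
  simpa [hx1] using hcb x hx

/-- A `W`-nonnegative vector is controlled by its component in the positive spectral subspace. -/
lemma IsPosNegPair.norm_neg_part_le {W Pp Pm : H →L[ℂ] H} (h : IsPosNegPair W Pp Pm)
    {s i : ℝ} (hs : ∀ x : H, Pp x = x → (⟪x, W x⟫).re ≤ s * ‖x‖ ^ 2) (hi0 : 0 < i)
    (hi : ∀ x : H, Pm x = x → i * ‖x‖ ^ 2 ≤ -(⟪x, W x⟫).re) {z : H}
    (hz : 0 ≤ (⟪z, W z⟫).re) : ‖Pm z‖ ≤ Real.sqrt (s / i) * ‖Pp z‖ := by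
  rw [h.re_inner_split] at hz
  have h1 := hs _ (h.apply_apply z)
  have h2 := hi _ (h.neg.apply_apply z)
  have h3 : ‖Pm z‖ ^ 2 ≤ s / i * ‖Pp z‖ ^ 2 := by
    rw [div_mul_eq_mul_div, le_div_iff₀ hi0]
    linarith
  rw [← Real.sqrt_sq (norm_nonneg (Pp z)), ← Real.sqrt_mul' _ (sq_nonneg _)]
  exact Real.le_sqrt_of_sq_le h3

/-- For complementary projections onto a `W`-nonnegative and a `W`-nonpositive subspace, no
nonzero vector of the positive spectral subspace is `W`-orthogonal to the first range. -/
lemma IsPosNegPair.eq_zero_of_orthogonal {W Pp Pm Qp Qm : H →L[ℂ] H} (h : IsPosNegPair W Pp Pm)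
    (hWsa : IsSelfAdjoint W) (hW : IsUnit W) (hsum : Qp + Qm = 1)
    (hp : ∀ x : H, 0 ≤ (⟪Qp x, W (Qp x)⟫).re) (hm : ∀ x : H, (⟪Qm x, W (Qm x)⟫).re ≤ 0)
    {y : H} (hy : Pp y = y) (horth : ∀ x : H, ⟪Qp x, W y⟫ = 0) : y = 0 := by
  obtain ⟨c, hc, hcb⟩ := h.exists_pos_lower_bound hWsa hW
  have hQ : Qm y = y - Qp y :=
    eq_sub_of_add_eq' (by simpa using DFunLike.congr_fun hsum y)
  have h1 : ⟪y, W (Qp y)⟫ = 0 := by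
    rw [← inner_conj_symm, hWsa.isSymmetric.apply_clm, horth, map_zero]
  have h2 := hm y
  simp only [hQ, map_sub, inner_sub_left, inner_sub_right, horth, h1, Complex.sub_re,
    Complex.zero_re] at h2
  have h3 := hp y
  have h4 := hcb y hy
  have h5 : c * ‖y‖ ^ 2 ≤ 0 := by linarith
  have h6 : ‖y‖ ^ 2 ≤ 0 := nonpos_of_mul_nonpos_right h5 hc
  simpa using le_antisymm h6 (sq_nonneg _)

/-- The operator `P₊Q₊ + P₋Q₋` comparing the two decompositions is invertible. -/
lemma IsPosNegPair.isUnit_comparison {W Pp Pm Qp Qm : H →L[ℂ] H} (h : IsPosNegPair W Pp Pm)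
    (hWsa : IsSelfAdjoint W) (hW : IsUnit W) (hsum : Qp + Qm = 1)
    (hQp : IsIdempotentElem Qp) (hQm : IsIdempotentElem Qm)
    (hp : ∀ x : H, 0 ≤ (⟪Qp x, W (Qp x)⟫).re) (hm : ∀ x : H, (⟪Qm x, W (Qm x)⟫).re ≤ 0)
    {C D : ℝ} (hC : ∀ x : H, ‖Pm (Qp x)‖ ≤ C * ‖Pp (Qp x)‖)
    (hD : ∀ x : H, ‖Pp (Qm x)‖ ≤ D * ‖Pm (Qm x)‖) :
    IsUnit (Pp * Qp + Pm * Qm) := by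
  set B := Pp * Qp + Pm * Qm with hB
  have hBz (z : H) : B z = Pp (Qp z) + Pm (Qm z) := rfl
  have hQ (z : H) : Qp z + Qm z = z := by simpa using DFunLike.congr_fun hsum z
  have hQpp (z : H) : Qp (Qp z) = Qp z := DFunLike.congr_fun hQp z
  have hQmm (z : H) : Qm (Qm z) = Qm z := DFunLike.congr_fun hQm z
  have hQmp (z : H) : Qm (Qp z) = 0 := by simpa [hQpp] using hQ (Qp z)
  have hQpm (z : H) : Qp (Qm z) = 0 := by simpa [hQmm] using hQ (Qm z)
  have hanti : AntilipschitzWith (Real.toNNReal (2 + |C| + |D|)) B := by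
    refine ContinuousLinearMap.antilipschitz_of_bound B fun z => ?_
    rw [Real.coe_toNNReal _ (by positivity)]
    have hn := h.norm_sq (Qp z) (Qm z)
    rw [← hBz] at hn
    have h1 : ‖Pp (Qp z)‖ ≤ ‖B z‖ := by
      apply le_of_sq_le_sq _ (norm_nonneg _)
      nlinarith [sq_nonneg ‖Pm (Qm z)‖]
    have h2 : ‖Pm (Qm z)‖ ≤ ‖B z‖ := by
      apply le_of_sq_le_sq _ (norm_nonneg _)
      nlinarith [sq_nonneg ‖Pp (Qp z)‖]
    have h3 : ‖Pm (Qp z)‖ ≤ |C| * ‖B z‖ :=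
      (hC z).trans (mul_le_mul (le_abs_self C) h1 (norm_nonneg _) (abs_nonneg _))
    have h4 : ‖Pp (Qm z)‖ ≤ |D| * ‖B z‖ :=
      (hD z).trans (mul_le_mul (le_abs_self D) h2 (norm_nonneg _) (abs_nonneg _))
    have h5 : z = (Pp (Qp z) + Pm (Qp z)) + (Pp (Qm z) + Pm (Qm z)) := by
      rw [h.apply_add, h.apply_add, hQ]
    calc ‖z‖ = ‖(Pp (Qp z) + Pm (Qp z)) + (Pp (Qm z) + Pm (Qm z))‖ := congrArg _ h5
      _ ≤ (‖Pp (Qp z)‖ + ‖Pm (Qp z)‖) + (‖Pp (Qm z)‖ + ‖Pm (Qm z)‖) :=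
        (norm_add_le _ _).trans (add_le_add (norm_add_le _ _) (norm_add_le _ _))
      _ ≤ (2 + |C| + |D|) * ‖B z‖ := by linarith
  have hclosed : IsClosed (B.range : Set H) :=
    hanti.isClosed_range B.uniformContinuous
  have hrange : B.range = ⊤ := by
    have : CompleteSpace B.range := hclosed.completeSpace_coe
    rw [← Submodule.orthogonal_eq_bot_iff, Submodule.eq_bot_iff]
    intro y hy
    have horth (z : H) : ⟪B z, y⟫ = 0 := hy _ ⟨z, rfl⟩
    obtain ⟨V, hV⟩ := hW.exists_right_inv
    set v := V y with hv
    have hWv : W v = y := DFunLike.congr_fun hV y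
    have hPv : Pp v = 0 := by
      refine h.eq_zero_of_orthogonal hWsa hW hsum hp hm (h.apply_apply v) fun x => ?_
      rw [← h.apply_comm, hWv, ← h.inner_apply_left, ← horth (Qp x), hBz, hQpp, hQmp, map_zero,
        add_zero]
    have hMv : Pm v = 0 := by
      refine h.neg.eq_zero_of_orthogonal hWsa.neg hW.neg (by rw [add_comm, hsum])
        (fun x => by simpa using hm x) (fun x => by simpa using hp x)
        (h.neg.apply_apply v) fun x => ?_
      rw [← h.neg.apply_comm, neg_apply, hWv, map_neg, inner_neg_right,
        ← h.neg.inner_apply_left, neg_eq_zero, ← horth (Qm x), hBz, hQmm, hQpm, map_zero, zero_add]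
    rw [← hWv, ← h.apply_add v, hPv, hMv, add_zero, map_zero]
  exact ContinuousLinearMap.isUnit_iff_bijective.mpr
    ⟨hanti.injective, LinearMap.range_eq_top.mp hrange⟩

/-- The range of `Q₊` is the graph of an angular operator over the positive spectral subspace. -/
lemma IsPosNegPair.exists_angular {W Pp Pm Qp Qm : H →L[ℂ] H} (h : IsPosNegPair W Pp Pm)
    (hQp : IsIdempotentElem Qp) (hsum : Qp + Qm = 1)
    (hunit : IsUnit (Pp * Qp + Pm * Qm)) {C D : ℝ}
    (hC : ∀ x : H, ‖Pm (Qp x)‖ ≤ C * ‖Pp (Qp x)‖)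
    (hD : ∀ x : H, ‖Pp (Qm x)‖ ≤ D * ‖Pm (Qm x)‖) :
    ∃ K : H →L[ℂ] H, (∀ u : H, K (Pp u) = K u) ∧ (∀ u : H, Pm (K u) = K u) ∧
      Set.range ⇑Qp = {z : H | ∃ x : H, Pp x = x ∧ z = x + K x} ∧
      ∀ x : H, Pp x = x → ‖K x‖ ≤ C * ‖x‖ := by
  obtain ⟨A, hA⟩ := hunit.exists_right_inv
  obtain ⟨A', hA'⟩ := hunit.exists_left_inv
  obtain rfl : A' = A := left_inv_eq_right_inv hA' hA
  have hQ (z : H) : Qp z + Qm z = z := by simpa using DFunLike.congr_fun hsum z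
  have hQQ (z : H) : Qp (Qp z) = Qp z := DFunLike.congr_fun hQp z
  have hQm0 (z : H) : Qm (Qp z) = 0 := by simpa [hQQ] using hQ (Qp z)
  have key {x : H} (hx : Pp x = x) : Qp (A' x) = A' x ∧ Pp (A' x) = x := by
    have hAx : Pp (Qp (A' x)) + Pm (Qm (A' x)) = x := DFunLike.congr_fun hA x
    have h1 : Pp (Qp (A' x)) = x := by
      simpa [h.apply_apply, h.apply_apply_neg, hx] using congrArg Pp hAx
    have h2 : Pm (Qm (A' x)) = 0 := by simpa [h1] using hAx
    have h3 : Pp (Qm (A' x)) = 0 := by simpa [h2] using hD (A' x)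
    have h4 : Qm (A' x) = 0 := by rw [← h.apply_add (Qm (A' x)), h2, h3, add_zero]
    have h5 : Qp (A' x) = A' x := by simpa [h4] using hQ (A' x)
    exact ⟨h5, by rw [← h5, h1]⟩
  refine ⟨Pm * A' * Pp, fun u => by simp [h.apply_apply], fun u => h.neg.apply_apply _, ?_, ?_⟩
  · ext z
    constructor
    · rintro ⟨u, rfl⟩
      refine ⟨Pp (Qp u), h.apply_apply _, ?_⟩
      have h1 : A' (Pp (Qp u)) = Qp u := by
        have := DFunLike.congr_fun hA' (Qp u)
        simpa [hQQ, hQm0] using this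
      simp [h.apply_apply, h1, h.apply_add]
    · rintro ⟨x, hx, rfl⟩
      obtain ⟨h1, h2⟩ := key hx
      refine ⟨A' x, ?_⟩
      calc Qp (A' x) = Pp (A' x) + Pm (A' x) := by rw [h1, h.apply_add]
        _ = x + (Pm * A' * Pp) x := by simp [h2, hx]
  · intro x hx
    obtain ⟨h1, h2⟩ := key hx
    have := hC (A' x)
    rw [h1, h2] at this
    simpa [hx] using this

omit [CompleteSpace H] in
lemma isResolventAt_res {T : H →ₗ.[ℂ] H} {z : ℂ} (hz : z ∈ resolventSet T) :
    IsResolventAt T z (res T z) := by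
  rw [res, dif_pos hz]
  exact Classical.choose_spec hz

/-- For a `W`-accretive operator the resolvents on the imaginary axis are `W`-accretive. -/
lemma re_inner_res_nonneg {W : H →L[ℂ] H} (hWsa : IsSelfAdjoint W) {T : H →ₗ.[ℂ] H}
    (hacc : ∀ u : T.domain, 0 ≤ (⟪(u : H), W (T u)⟫).re) {η : ℝ}
    (hη : Complex.I * (η : ℂ) ∈ resolventSet T) (x : H) :
    0 ≤ (⟪W x, res T (Complex.I * (η : ℂ)) x⟫).re := by
  obtain ⟨hu, hx⟩ := (isResolventAt_res hη).2 x
  generalize res T (Complex.I * (η : ℂ)) x = u at hu hx ⊢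
  have h1 : (⟪W x, u⟫).re = (⟪u, W x⟫).re := inner_re_symm (𝕜 := ℂ) _ _
  have h2 : (⟪u, W u⟫).im = 0 := hWsa.isSymmetric.im_inner_self_apply u
  rw [h1, ← hx, map_sub, map_smul, inner_sub_right, inner_smul_right]
  simpa [h2] using hacc ⟨u, hu⟩

lemma re_intervalIntegral_nonneg {f : ℝ → ℂ} {a b : ℝ} (hab : a ≤ b)
    (hf : ∀ t ∈ Set.Ioc a b, 0 ≤ (f t).re) : 0 ≤ (∫ t in a..b, f t).re := by
  rw [intervalIntegral.integral_of_le hab]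
  by_cases hint : Integrable f (volume.restrict (Set.Ioc a b))
  · have := integral_re (𝕜 := ℂ) hint
    change 0 ≤ RCLike.re (∫ t in Set.Ioc a b, f t)
    rw [← this]
    exact setIntegral_nonneg measurableSet_Ioc hf
  · rw [integral_undef hint, Complex.zero_re]

/-- The principal value integral of the resolvent of a `W`-accretive operator is
`W`-accretive. -/
lemma re_inner_pv_nonneg {W : H →L[ℂ] H} (hWsa : IsSelfAdjoint W) {T : H →ₗ.[ℂ] H}
    (hacc : ∀ u : T.domain, 0 ≤ (⟪(u : H), W (T u)⟫).re)
    (hres : ∀ η : ℝ, η ≠ 0 → (Complex.I * (η : ℂ)) ∈ resolventSet T) {x : H} {l : ℂ}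
    (hpv : Tendsto (fun p : ℝ × ℝ => ((Real.pi : ℂ))⁻¹ *
          ((∫ η in p.1..p.2, ⟪W x, res T (Complex.I * (η : ℂ)) x⟫) +
            ∫ η in (-p.2)..(-p.1), ⟪W x, res T (Complex.I * (η : ℂ)) x⟫))
        ((𝓝[>] (0 : ℝ)) ×ˢ atTop) (𝓝 l)) : 0 ≤ l.re := by
  refine ge_of_tendsto ((Complex.continuous_re.tendsto l).comp hpv) ?_
  have h1 : ∀ᶠ a in 𝓝[>] (0 : ℝ), a ∈ Set.Ioc (0 : ℝ) 1 := Ioc_mem_nhdsGT one_pos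
  filter_upwards [h1.prod_mk (eventually_ge_atTop (1 : ℝ))] with p hp
  obtain ⟨⟨hp0, hp1⟩, hp2⟩ := hp
  have hle : p.1 ≤ p.2 := hp1.trans hp2
  have hA := re_intervalIntegral_nonneg
    (f := fun η : ℝ => ⟪W x, res T (Complex.I * (η : ℂ)) x⟫) hle fun t ht =>
      re_inner_res_nonneg hWsa hacc (hres t (hp0.trans ht.1).ne') x
  have hB := re_intervalIntegral_nonneg
    (f := fun η : ℝ => ⟪W x, res T (Complex.I * (η : ℂ)) x⟫) (neg_le_neg hle) fun t ht =>
      re_inner_res_nonneg hWsa hacc (hres t (ht.2.trans_lt (neg_lt_zero.mpr hp0)).ne) x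
  rw [Function.comp_apply, ← Complex.ofReal_inv, Complex.re_ofReal_mul, Complex.add_re]
  exact mul_nonneg (inv_nonneg.mpr Real.pi_pos.le) (add_nonneg hA hB)

theorem statement_6
    (W : H →L[ℂ] H) (hWsa : IsSelfAdjoint W)
    (T : H →ₗ.[ℂ] H) (hclosed : T.IsClosed)
    (hacc : ∀ u : T.domain, 0 ≤ (⟪(u : H), W (T u)⟫).re)
    (hres : ∀ η : ℝ, η ≠ 0 → (Complex.I * (η : ℂ)) ∈ resolventSet T)
    (Qp Qm : H →L[ℂ] H) (hsum : Qp + Qm = 1)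
    (hQp : IsIdempotentElem Qp) (hQm : IsIdempotentElem Qm)
    (hpv : ∀ x y : H,
      Tendsto (fun p : ℝ × ℝ => ((Real.pi : ℂ))⁻¹ *
          ((∫ η in p.1..p.2, ⟪y, res T (Complex.I * (η : ℂ)) x⟫) +
            ∫ η in (-p.2)..(-p.1), ⟪y, res T (Complex.I * (η : ℂ)) x⟫))
        ((𝓝[>] (0 : ℝ)) ×ˢ atTop) (𝓝 ⟪y, Qp x - Qm x⟫)) :
    -- `Q₊H` is `W`-nonnegative and `Q₋H` is `W`-nonpositive
    (∀ x : H, 0 ≤ (⟪Qp x, W (Qp x)⟫).re) ∧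
    (∀ x : H, (⟪Qm x, W (Qm x)⟫).re ≤ 0) ∧
    -- the second part, under the assumption `0 ∈ ρ(W)`
    (IsUnit W →
      ∀ Pp Pm : H →L[ℂ] H, IsPosNegPair W Pp Pm →
      ∀ sp sm ip im : ℝ,
        IsLUB {r : ℝ | ∃ x : H, Pp x = x ∧ ‖x‖ = 1 ∧ r = (⟪x, W x⟫).re} sp →
        IsLUB {r : ℝ | ∃ x : H, Pm x = x ∧ ‖x‖ = 1 ∧ r = -(⟪x, W x⟫).re} sm →
        IsGLB {r : ℝ | ∃ x : H, Pp x = x ∧ ‖x‖ = 1 ∧ r = (⟪x, W x⟫).re} ip →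
        IsGLB {r : ℝ | ∃ x : H, Pm x = x ∧ ‖x‖ = 1 ∧ r = -(⟪x, W x⟫).re} im →
        ∃ Kp Km : H →L[ℂ] H,
          (∀ u : H, Kp (Pp u) = Kp u) ∧ (∀ u : H, Pm (Kp u) = Kp u) ∧
          (∀ u : H, Km (Pm u) = Km u) ∧ (∀ u : H, Pp (Km u) = Km u) ∧
          Set.range ⇑Qp = {z : H | ∃ x : H, Pp x = x ∧ z = x + Kp x} ∧
          Set.range ⇑Qm = {z : H | ∃ y : H, Pm y = y ∧ z = y + Km y} ∧
          (∀ x : H, Pp x = x → ‖Kp x‖ ≤ Real.sqrt (sp / im) * ‖x‖) ∧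
          (∀ y : H, Pm y = y → ‖Km y‖ ≤ Real.sqrt (sm / ip) * ‖y‖)) := by
  have hS (x : H) : 0 ≤ (⟪W x, Qp x - Qm x⟫).re :=
    re_inner_pv_nonneg hWsa hacc hres (hpv x (W x))
  have hQ (z : H) : Qp z + Qm z = z := by simpa using DFunLike.congr_fun hsum z
  have hQpp (z : H) : Qp (Qp z) = Qp z := DFunLike.congr_fun hQp z
  have hQmm (z : H) : Qm (Qm z) = Qm z := DFunLike.congr_fun hQm z
  have hQmp (z : H) : Qm (Qp z) = 0 := by simpa [hQpp] using hQ (Qp z)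
  have hQpm (z : H) : Qp (Qm z) = 0 := by simpa [hQmm] using hQ (Qm z)
  have hp (x : H) : 0 ≤ (⟪Qp x, W (Qp x)⟫).re := by
    have := hS (Qp x)
    rwa [hQpp, hQmp, sub_zero, hWsa.isSymmetric.apply_clm] at this
  have hm (x : H) : (⟪Qm x, W (Qm x)⟫).re ≤ 0 := by
    have := hS (Qm x)
    rw [hQpm, hQmm, zero_sub, inner_neg_right, Complex.neg_re,
      hWsa.isSymmetric.apply_clm] at this
    linarith
  refine ⟨hp, hm, fun hW Pp Pm h sp sm ip im hsp hsm hip him => ?_⟩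
  have hsm' : IsLUB {r : ℝ | ∃ x : H, Pm x = x ∧ ‖x‖ = 1 ∧ r = (⟪x, (-W) x⟫).re} sm := by
    simpa using hsm
  have him' : IsGLB {r : ℝ | ∃ x : H, Pm x = x ∧ ‖x‖ = 1 ∧ r = (⟪x, (-W) x⟫).re} im := by
    simpa using him
  have hC (x : H) : ‖Pm (Qp x)‖ ≤ Real.sqrt (sp / im) * ‖Pp (Qp x)‖ :=
    h.norm_neg_part_le (fun y hy => re_inner_le_of_isLUB hsp hy)
      (h.neg.isGLB_pos hWsa.neg hW.neg him')
      (fun y hy => by simpa using le_re_inner_of_isGLB him' hy) (hp x)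
  have hD (x : H) : ‖Pp (Qm x)‖ ≤ Real.sqrt (sm / ip) * ‖Pm (Qm x)‖ :=
    h.neg.norm_neg_part_le (fun y hy => re_inner_le_of_isLUB hsm' hy)
      (h.isGLB_pos hWsa hW hip)
      (fun y hy => by simpa using le_re_inner_of_isGLB hip hy) (by simpa using hm x)
  have hunit := h.isUnit_comparison hWsa hW hsum hQp hQm hp hm hC hD
  obtain ⟨Kp, hK1, hK2, hK3, hK4⟩ := h.exists_angular hQp hsum hunit hC hD
  obtain ⟨Km, hL1, hL2, hL3, hL4⟩ := h.neg.exists_angular hQm (by rw [add_comm, hsum])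
    (by rwa [add_comm]) hD hC
  exact ⟨Kp, Km, hK1, hK2, hL1, hL2, hK3, hL3, hK4, hL4⟩

end Statement6

end Paper
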